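/- arXiv:1407.3293 — 7 statements merged into one kernel-verified Lean document; each statement's English description precedes it below -/
import Mathlib

section
/- Let a, b ≥ 2 be integers with a ≠ b, and let A₁,…,A_a, M, B₁,…,B_b be as in the set-system context. If there is no single element common to all a+b+1 sets, then there exist distinct elements x ≠ y with M = {x, y} such that (after possibly exchanging the names of x and y): x ∈ Aᵢ for every i = 1,…,a; y ∈ Bⱼ for every j = 1,…,b; for every pair (i,j) the intersection Aᵢ ∩ Bⱼ is a singleton {z_{ij}} with z_{ij} ∉ {x, y}; the map (i,j) ↦ z_{ij} is injective; and moreover Aᵢ = {x} ∪ {z_{i1},…,z_{ib}} and Bⱼ = {y} ∪ {z_{1j},…,z_{aj}}. (This is the key combinatorial classification in the proof of Theorem 5.1: there are only two possible homological embeddings of the cap DΓ_{a,b}.) -/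
lemma count_aux {α ι : Type*} [DecidableEq α] [Fintype ι] [DecidableEq ι] (F : ι → Finset α)
    (x y : α) (hP : ∀ i i', i ≠ i' → (F i ∩ F i').card = 1)
    (hex : ∀ i, x ∈ F i ↔ y ∉ F i) (k : ι) (hk : y ∈ F k) :
    (Finset.univ.filter (fun i => x ∈ F i)).card + 1 ≤ (F k).card := by
  have hxk : x ∉ F k := fun h => (hex k).1 h hk
  have h1 : ∀ i, x ∈ F i → ∃ w, w ∈ F i ∧ w ∈ F k := by
    intro i hi
    have hne : i ≠ k := by rintro rfl; exact hxk hi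
    obtain ⟨w, hw⟩ := Finset.card_eq_one.1 (hP i k hne)
    have : w ∈ F i ∩ F k := by rw [hw]; simp
    exact ⟨w, Finset.mem_inter.1 this⟩
  haveI : Nonempty α := ⟨x⟩
  choose! w hw using h1
  rw [← Finset.card_erase_add_one hk]
  refine Nat.add_le_add_right (Finset.card_le_card_of_injOn w ?_ ?_) 1
  · intro i hi
    have hi' : x ∈ F i := by simpa using hi
    have h := hw i hi'
    have : w i ≠ y := by
      intro e
      rw [e] at h
      exact (hex i).1 hi' h.1
    simp [this, h.2]
  · intro i hi j hj e
    have hi' : x ∈ F i := by simpa using hi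
    have hj' : x ∈ F j := by simpa using hj
    by_contra hne
    have h := Finset.card_le_one.1 (hP i j hne).le x (by simp [hi', hj']) (w i)
      (by
        have h2 := (hw j hj').1
        have h3 := (hw i hi').1
        rw [← e] at h2
        simp [h2, h3])
    exact hxk (h ▸ (hw i hi').2)

lemma core_aux {α : Type*} [DecidableEq α] (a b : ℕ) (hab : a < b)
    (A : Fin a → Finset α) (B : Fin b → Finset α) (x y : α)
    (hA : ∀ i, (A i).card = b + 1) (hB : ∀ j, (B j).card = a + 1)
    (hP : ∀ i i', i ≠ i' → (Sum.elim A B i ∩ Sum.elim A B i').card = 1)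
    (hex : ∀ i, x ∈ Sum.elim A B i ↔ y ∉ Sum.elim A B i)
    (hy : ¬ ((∀ i, y ∈ A i) ∧ (∀ j, y ∈ B j))) (j0 : Fin b) (hj0 : y ∈ B j0) :
    (∀ i, x ∈ A i) ∧ (∀ j, y ∈ B j) := by
  have hex' : ∀ i, y ∈ Sum.elim A B i ↔ x ∉ Sum.elim A B i := fun i => by
    rw [hex i, not_not]
  have c1 := count_aux (Sum.elim A B) x y hP hex
  have c2 := count_aux (Sum.elim A B) y x hP hex'
  have tot := Finset.card_filter_add_card_filter_not (s := Finset.univ)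
    (fun i => x ∈ Sum.elim A B i)
  simp only [← hex', Finset.card_univ, Fintype.card_sum, Fintype.card_fin] at tot
  have d1 := c1 (Sum.inr j0) hj0
  simp only [Sum.elim_inr, hB] at d1
  have allB : ∀ j, y ∈ B j := by
    intro j
    by_contra h
    have d2 := c2 (Sum.inr j) ((hex _).2 h)
    simp only [Sum.elim_inr, hB] at d2
    omega
  refine ⟨?_, allB⟩
  have : ∃ i, y ∉ A i := by
    by_contra! h
    exact hy ⟨h, allB⟩
  obtain ⟨i0, hi0⟩ := this
  have d2 := c2 (Sum.inl i0) ((hex _).2 hi0)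
  simp only [Sum.elim_inl, hA] at d2
  intro i
  by_contra hx
  have sub : (Finset.univ.filter (fun i => x ∈ Sum.elim A B i)) ⊆
      (Finset.univ.erase i).image Sum.inl := by
    rintro (k | k) hk
    · have hk' : x ∈ A k := by simpa using hk
      have : k ≠ i := by rintro rfl; exact hx hk'
      simp [this]
    · have hk' : x ∈ B k := by simpa using hk
      exact absurd (allB k) ((hex (Sum.inr k)).1 hk')
  have l1 := (Finset.card_le_card sub).trans Finset.card_image_le
  rw [Finset.card_erase_of_mem (Finset.mem_univ _), Finset.card_univ, Fintype.card_fin] at l1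
  have := i.pos
  omega

lemma core_aux2 {α : Type*} [DecidableEq α] (a b : ℕ) (hab : a < b)
    (A : Fin a → Finset α) (M : Finset α) (B : Fin b → Finset α)
    (hA : ∀ i, (A i).card = b + 1) (hM : M.card = 2) (hB : ∀ j, (B j).card = a + 1)
    (hAA : ∀ i i', i ≠ i' → (A i ∩ A i').card = 1)
    (hAM : ∀ i, (A i ∩ M).card = 1)
    (hAB : ∀ i j, (A i ∩ B j).card = 1)
    (hMB : ∀ j, (M ∩ B j).card = 1)
    (hBB : ∀ j j', j ≠ j' → (B j ∩ B j').card = 1)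
    (hno : ¬ ∃ x, (∀ i, x ∈ A i) ∧ x ∈ M ∧ (∀ j, x ∈ B j)) :
    ∃ x y, x ≠ y ∧ M = {x, y} ∧ (∀ i, x ∈ A i) ∧ (∀ j, y ∈ B j) := by
  obtain ⟨x, y, hxy, rfl⟩ := Finset.card_eq_two.1 hM
  have hP : ∀ i i', i ≠ i' → (Sum.elim A B i ∩ Sum.elim A B i').card = 1 := by
    rintro (i | i) (j | j) h
    · exact hAA i j (by simpa using h)
    · exact hAB i j
    · rw [Finset.inter_comm]; exact hAB j i
    · exact hBB i j (by simpa using h)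
  have gen : ∀ S : Finset α, (S ∩ {x, y}).card = 1 → (x ∈ S ↔ y ∉ S) := by
    intro S h
    by_cases h1 : x ∈ S <;> by_cases h2 : y ∈ S <;>
      simp [h1, h2, Finset.inter_insert_of_mem, Finset.inter_insert_of_notMem, hxy] at h ⊢
  have hex : ∀ i, x ∈ Sum.elim A B i ↔ y ∉ Sum.elim A B i := by
    rintro (i | i)
    · exact gen _ (hAM i)
    · exact gen _ (by rw [Finset.inter_comm]; exact hMB i)
  have hex' : ∀ i, y ∈ Sum.elim A B i ↔ x ∉ Sum.elim A B i := fun i => by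
    rw [hex i, not_not]
  have hx : ¬ ((∀ i, x ∈ A i) ∧ (∀ j, x ∈ B j)) := fun h => hno ⟨x, h.1, by simp, h.2⟩
  have hy : ¬ ((∀ i, y ∈ A i) ∧ (∀ j, y ∈ B j)) := fun h => hno ⟨y, h.1, by simp, h.2⟩
  let j0 : Fin b := ⟨0, by omega⟩
  by_cases h : y ∈ B j0
  · exact ⟨x, y, hxy, rfl, core_aux a b hab A B x y hA hB hP hex hy j0 h⟩
  · exact ⟨y, x, hxy.symm, Finset.pair_comm _ _,
      core_aux a b hab A B y x hA hB hP hex' hx j0 ((hex (Sum.inr j0)).2 h)⟩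


/-- The key combinatorial classification in the proof of Theorem 5.1.
Sets `A₁, …, A_a` (of cardinality `b+1`), `M` (of cardinality `2`), and
`B₁, …, B_b` (of cardinality `a+1`) pairwise intersect in exactly one element.
If no single element is common to all `a + b + 1` sets, then `M = {x, y}` with
(after possibly exchanging `x` and `y`) `x` in every `Aᵢ`, `y` in every `Bⱼ`,
each `Aᵢ ∩ Bⱼ` a singleton `{z i j}` disjoint from `{x, y}`, the `z i j` pairwise
distinct, and `Aᵢ = {x, z_{i1}, …, z_{ib}}`, `Bⱼ = {y, z_{1j}, …, z_{aj}}`. -/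
theorem stmt_0 {α : Type*} [DecidableEq α] (a b : ℕ) (ha : 2 ≤ a) (hb : 2 ≤ b)
    (hab : a ≠ b)
    (A : Fin a → Finset α) (M : Finset α) (B : Fin b → Finset α)
    (hA : ∀ i, (A i).card = b + 1) (hM : M.card = 2) (hB : ∀ j, (B j).card = a + 1)
    (hAA : ∀ i i', i ≠ i' → (A i ∩ A i').card = 1)
    (hAM : ∀ i, (A i ∩ M).card = 1)
    (hAB : ∀ i j, (A i ∩ B j).card = 1)
    (hMB : ∀ j, (M ∩ B j).card = 1)
    (hBB : ∀ j j', j ≠ j' → (B j ∩ B j').card = 1)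
    (hno : ¬ ∃ x, (∀ i, x ∈ A i) ∧ x ∈ M ∧ (∀ j, x ∈ B j)) :
    ∃ x y, x ≠ y ∧ M = {x, y} ∧ (∀ i, x ∈ A i) ∧ (∀ j, y ∈ B j) ∧
      ∃ z : Fin a → Fin b → α,
        (∀ i j, A i ∩ B j = {z i j}) ∧
        (∀ i j, z i j ≠ x ∧ z i j ≠ y) ∧
        (Function.Injective fun p : Fin a × Fin b => z p.1 p.2) ∧
        (∀ i, A i = insert x (Finset.image (fun j => z i j) Finset.univ)) ∧
        (∀ j, B j = insert y (Finset.image (fun i => z i j) Finset.univ)) := by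
  have main : ∃ x y, x ≠ y ∧ M = {x, y} ∧ (∀ i, x ∈ A i) ∧ (∀ j, y ∈ B j) := by
    rcases lt_or_gt_of_ne hab with h | h
    · exact core_aux2 a b h A M B hA hM hB hAA hAM hAB hMB hBB hno
    · obtain ⟨x, y, h1, h2, h3, h4⟩ := core_aux2 b a h B M A hB hM hA hBB
        (fun j => by rw [Finset.inter_comm]; exact hMB j)
        (fun i j => by rw [Finset.inter_comm]; exact hAB j i)
        (fun i => by rw [Finset.inter_comm]; exact hAM i) hAA
        (fun ⟨x, p, q, r⟩ => hno ⟨x, r, q, p⟩)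
      exact ⟨y, x, h1.symm, by rw [h2, Finset.pair_comm], h4, h3⟩
  obtain ⟨x, y, hxy, rfl, hxA, hyB⟩ := main
  refine ⟨x, y, hxy, rfl, hxA, hyB, ?_⟩
  have hyA : ∀ i, y ∉ A i := fun i h =>
    hxy (Finset.card_le_one.1 (hAM i).le x (by simp [hxA]) y (by simp [h]))
  have hxB : ∀ j, x ∉ B j := fun j h =>
    hxy (Finset.card_le_one.1 (hMB j).le x (by simp [h]) y (by simp [hyB]))
  choose z hz using fun i j => Finset.card_eq_one.1 (hAB i j)
  have hzA : ∀ i j, z i j ∈ A i := fun i j =>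
    (Finset.mem_inter.1 (by rw [hz]; simp : z i j ∈ A i ∩ B j)).1
  have hzB : ∀ i j, z i j ∈ B j := fun i j =>
    (Finset.mem_inter.1 (by rw [hz]; simp : z i j ∈ A i ∩ B j)).2
  have hzx : ∀ i j, z i j ≠ x := fun i j e => hxB j (e ▸ hzB i j)
  have hzy : ∀ i j, z i j ≠ y := fun i j e => hyA i (e ▸ hzA i j)
  have inj1 : ∀ i i' j j', z i j = z i' j' → i = i' := by
    intro i i' j j' e
    by_contra hne
    exact hzx i j (Finset.card_le_one.1 (hAA i i' hne).le _
      (Finset.mem_inter.2 ⟨hzA i j, e ▸ hzA i' j'⟩) _ (Finset.mem_inter.2 ⟨hxA i, hxA i'⟩))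
  have inj2 : ∀ i i' j j', z i j = z i' j' → j = j' := by
    intro i i' j j' e
    by_contra hne
    exact hzy i j (Finset.card_le_one.1 (hBB j j' hne).le _
      (Finset.mem_inter.2 ⟨hzB i j, e ▸ hzB i' j'⟩) _ (Finset.mem_inter.2 ⟨hyB j, hyB j'⟩))
  refine ⟨z, hz, fun i j => ⟨hzx i j, hzy i j⟩, ?_, ?_, ?_⟩
  · rintro ⟨i, j⟩ ⟨i', j'⟩ e
    exact Prod.ext (inj1 _ _ _ _ e) (inj2 _ _ _ _ e)
  · intro i
    symm
    apply Finset.eq_of_subset_of_card_le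
    · intro w hw
      simp only [Finset.mem_insert, Finset.mem_image, Finset.mem_univ, true_and] at hw
      rcases hw with rfl | ⟨j, rfl⟩
      · exact hxA i
      · exact hzA i j
    · rw [Finset.card_insert_of_notMem (by simp [hzx]),
        Finset.card_image_of_injective _ (fun j j' e => inj2 i i j j' e), hA]
      simp
  · intro j
    symm
    apply Finset.eq_of_subset_of_card_le
    · intro w hw
      simp only [Finset.mem_insert, Finset.mem_image, Finset.mem_univ, true_and] at hw
      rcases hw with rfl | ⟨i, rfl⟩
      · exact hyB j
      · exact hzB i j
    · rw [Finset.card_insert_of_notMem (by simp [hzy]),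
        Finset.card_image_of_injective _ (fun i i' e => inj1 i i' j j e), hB]
      simp
end

section
/- Let a, b ≥ 2 be integers and let A₁,…,A_a, M, B₁,…,B_b be as in the set-system context. Then the total number of distinct elements appearing in the union A₁ ∪ ⋯ ∪ A_a ∪ M ∪ B₁ ∪ ⋯ ∪ B_b equals 2ab + 2 if all a+b+1 sets share a common element, and equals ab + 2 otherwise. In particular the union has either 2ab+2 or ab+2 elements, and the first case uses strictly more elements than the second. (This gives the two possible Euler characteristics 2ab−a−b+2 and ab−a−b+2 of the minimal symplectic fillings in Theorem 5.1.) -/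
theorem aux_inter {α ι : Type*} [DecidableEq α] (s : Finset α) (T : ι → Finset α)
    (Q : Finset ι) (hQ : ∀ i ∈ Q, ∀ j ∈ Q, i ≠ j → Disjoint (T i) (T j))
    (h : ∀ j ∈ Q, (s ∩ T j).card = 1) : (s ∩ Q.biUnion T).card = Q.card := by
  rw [Finset.inter_biUnion, Finset.card_biUnion]
  · rw [Finset.sum_congr rfl h]; simp
  · intro i hi j hj hij
    exact (hQ i hi j hj hij).mono Finset.inter_subset_right Finset.inter_subset_right

theorem aux_union {α ι : Type*} [DecidableEq α] (T : ι → Finset α) (P Q : Finset ι)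
    (hP : ∀ i ∈ P, ∀ j ∈ P, i ≠ j → Disjoint (T i) (T j))
    (hQ : ∀ i ∈ Q, ∀ j ∈ Q, i ≠ j → Disjoint (T i) (T j))
    (h : ∀ i ∈ P, ∀ j ∈ Q, (T i ∩ T j).card = 1) :
    (P.biUnion T ∪ Q.biUnion T).card + P.card * Q.card
      = ∑ i ∈ P, (T i).card + ∑ i ∈ Q, (T i).card := by
  have h1 : (P.biUnion T ∩ Q.biUnion T).card = P.card * Q.card := by
    rw [Finset.biUnion_inter, Finset.card_biUnion]
    · rw [Finset.sum_congr rfl (fun i hi => aux_inter (T i) T Q hQ (h i hi))]; simp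
    · intro i hi j hj hij
      exact (hP i hi j hj hij).mono Finset.inter_subset_left Finset.inter_subset_left
  rw [← h1, Finset.card_union_add_card_inter, Finset.card_biUnion hP, Finset.card_biUnion hQ]

theorem aux_le {α ι : Type*} [DecidableEq α] (T : ι → Finset α) (P Q : Finset ι)
    (hQ : ∀ i ∈ Q, ∀ j ∈ Q, i ≠ j → Disjoint (T i) (T j))
    (h : ∀ i ∈ P, ∀ j ∈ Q, (T i ∩ T j).card = 1) (i : ι) (hi : i ∈ P) :
    Q.card ≤ (T i).card := by
  rw [← aux_inter (T i) T Q hQ (h i hi)]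
  exact Finset.card_le_card Finset.inter_subset_left

theorem aux_uniq {α : Type*} [DecidableEq α] {s t : Finset α} (h : (s ∩ t).card = 1)
    {x y : α} (hx : x ∈ s) (hx' : x ∈ t) (hy : y ∈ s) (hy' : y ∈ t) : x = y :=
  Finset.card_le_one.1 h.le x (by simp [hx, hx']) y (by simp [hy, hy'])

/-- The sphere system, with the two types of sets merged into one family. -/
theorem aux_main {α : Type*} [DecidableEq α] (a b : ℕ)
    (S : Fin a ⊕ Fin b → Finset α) (p q : α) (hpq : p ≠ q)
    (hA : ∀ i, (S (.inl i)).card = b + 1) (hB : ∀ j, (S (.inr j)).card = a + 1)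
    (hS : ∀ i j, i ≠ j → (S i ∩ S j).card = 1)
    (hM : ∀ i, (S i ∩ {p, q}).card = 1) (ha : 2 ≤ a) (hb : 2 ≤ b) :
    ((∃ x, (∀ i, x ∈ S i) ∧ (x = p ∨ x = q)) →
      (Finset.univ.biUnion S ∪ {p, q}).card = 2 * a * b + 2) ∧
    ((¬ ∃ x, (∀ i, x ∈ S i) ∧ (x = p ∨ x = q)) →
      (Finset.univ.biUnion S ∪ {p, q}).card = a * b + 2) := by
  classical
  have hor : ∀ i, p ∈ S i ∨ q ∈ S i := by
    intro i
    obtain ⟨x, hx⟩ := Finset.card_pos.1 (by rw [hM i]; exact one_pos : 0 < (S i ∩ {p, q}).card)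
    simp only [Finset.mem_inter, Finset.mem_insert, Finset.mem_singleton] at hx
    rcases hx with ⟨h, rfl | rfl⟩ <;> simp [h]
  have hnand : ∀ i, p ∈ S i → q ∉ S i := fun i h1 h2 =>
    hpq (aux_uniq (hM i) h1 (by simp) h2 (by simp))
  set P : Finset (Fin a ⊕ Fin b) := Finset.univ.filter (fun i => p ∈ S i) with hPdef
  set Q : Finset (Fin a ⊕ Fin b) := Finset.univ.filter (fun i => ¬ p ∈ S i) with hQdef
  have mP : ∀ i, i ∈ P ↔ p ∈ S i := by simp [hPdef]
  have mQ : ∀ i, i ∈ Q ↔ q ∈ S i := by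
    intro i
    have := hor i
    have := hnand i
    simp only [hQdef, Finset.mem_filter, Finset.mem_univ, true_and]
    tauto
  set T : Fin a ⊕ Fin b → Finset α := fun i => S i \ {p, q} with hT
  have cT : ∀ i, (T i).card + 1 = (S i).card := by
    intro i
    have := Finset.card_sdiff_add_card_inter (S i) {p, q}
    rw [hM i] at this
    exact this
  have cA : ∀ i, (T (.inl i)).card = b := fun i => by
    have := cT (.inl i); rw [hA] at this; omega
  have cB : ∀ i, (T (.inr i)).card = a := fun i => by
    have := cT (.inr i); rw [hB] at this; omega
  have hP : ∀ i ∈ P, ∀ j ∈ P, i ≠ j → Disjoint (T i) (T j) := by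
    intro i hi j hj hij
    rw [Finset.disjoint_left]
    intro x hx hx'
    simp only [hT, Finset.mem_sdiff, Finset.mem_insert, Finset.mem_singleton] at hx hx'
    exact hx.2 (Or.inl (aux_uniq (hS i j hij) hx.1 hx'.1 ((mP i).1 hi) ((mP j).1 hj)))
  have hQ : ∀ i ∈ Q, ∀ j ∈ Q, i ≠ j → Disjoint (T i) (T j) := by
    intro i hi j hj hij
    rw [Finset.disjoint_left]
    intro x hx hx'
    simp only [hT, Finset.mem_sdiff, Finset.mem_insert, Finset.mem_singleton] at hx hx'
    exact hx.2 (Or.inr (aux_uniq (hS i j hij) hx.1 hx'.1 ((mQ i).1 hi) ((mQ j).1 hj)))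
  have hPQ : ∀ i ∈ P, ∀ j ∈ Q, (T i ∩ T j).card = 1 := by
    intro i hi j hj
    rw [mP] at hi
    rw [mQ] at hj
    have h1 := hnand i hi
    have h2 : p ∉ S j := fun h => hnand j h hj
    have hij : i ≠ j := by rintro rfl; exact h2 hi
    rw [← hS i j hij]
    congr 1
    ext x
    simp only [hT, Finset.mem_inter, Finset.mem_sdiff, Finset.mem_insert, Finset.mem_singleton]
    constructor
    · tauto
    · rintro ⟨hx, hx'⟩
      have : x ≠ p := by rintro rfl; exact h2 hx'
      have : x ≠ q := by rintro rfl; exact h1 hx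
      tauto
  have hQP : ∀ i ∈ Q, ∀ j ∈ P, (T i ∩ T j).card = 1 := fun i hi j hj => by
    rw [Finset.inter_comm]; exact hPQ j hj i hi
  have key := aux_union T P Q hP hQ hPQ
  have leP := aux_le T P Q hQ hPQ
  have leQ := aux_le T Q P hP hQP
  have hsum : ∑ i ∈ P, (T i).card + ∑ i ∈ Q, (T i).card = 2 * a * b := by
    rw [Finset.sum_filter_add_sum_filter_not, Fintype.sum_sum_type]
    simp only [cA, cB, Finset.sum_const, Finset.card_univ, Fintype.card_fin, smul_eq_mul]
    ring
  have hcard : P.card + Q.card = a + b := by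
    rw [Finset.card_filter_add_card_filter_not]
    simp
  have hU : (Finset.univ.biUnion S ∪ {p, q}).card = (P.biUnion T ∪ Q.biUnion T).card + 2 := by
    rw [← Finset.card_pair hpq, ← Finset.card_union_of_disjoint]
    · congr 1
      ext x
      have e : x ∈ P.biUnion T ∪ Q.biUnion T ↔ (∃ i, x ∈ S i) ∧ x ∉ ({p, q} : Finset α) := by
        rw [Finset.mem_union, Finset.mem_biUnion, Finset.mem_biUnion]
        constructor
        · rintro (⟨i, -, h⟩ | ⟨i, -, h⟩) <;>
            exact ⟨⟨i, (Finset.mem_sdiff.1 h).1⟩, (Finset.mem_sdiff.1 h).2⟩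
        · rintro ⟨⟨i, h⟩, h'⟩
          rcases hor i with hi | hi
          · exact Or.inl ⟨i, (mP i).2 hi, Finset.mem_sdiff.2 ⟨h, h'⟩⟩
          · exact Or.inr ⟨i, (mQ i).2 hi, Finset.mem_sdiff.2 ⟨h, h'⟩⟩
      rw [Finset.mem_union, Finset.mem_union, e, Finset.mem_biUnion]
      simp only [Finset.mem_univ, true_and]
      tauto
    · rw [Finset.disjoint_left]
      intro x hx
      rw [Finset.mem_union, Finset.mem_biUnion, Finset.mem_biUnion] at hx
      rcases hx with (⟨i, -, h⟩ | ⟨i, -, h⟩) <;> exact (Finset.mem_sdiff.1 h).2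
  rw [hU]
  rw [hsum] at key
  constructor
  · rintro ⟨x, hx, rfl | rfl⟩
    · have h0 : Q.card = 0 := by
        rw [Finset.card_eq_zero, Finset.eq_empty_iff_forall_notMem]
        intro i hi
        exact hnand i (hx i) ((mQ i).1 hi)
      rw [h0] at key
      simp only [mul_zero, zero_mul, add_zero] at key
      omega
    · have h0 : P.card = 0 := by
        rw [Finset.card_eq_zero, Finset.eq_empty_iff_forall_notMem]
        intro i hi
        exact hnand i ((mP i).1 hi) (hx i)
      rw [h0] at key
      simp only [mul_zero, zero_mul, add_zero] at key
      omega
  · intro hne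
    have hp : ∃ i, i ∈ Q := by
      by_contra hcon
      push Not at hcon
      exact hne ⟨p, fun i => (hor i).resolve_right (fun h => hcon i ((mQ i).2 h)), Or.inl rfl⟩
    have hq : ∃ i, i ∈ P := by
      by_contra hcon
      push Not at hcon
      exact hne ⟨q, fun i => (hor i).resolve_left (fun h => hcon i ((mP i).2 h)), Or.inr rfl⟩
    have hmem : ∀ i, i ∈ P ∨ i ∈ Q := fun i => by rw [mP, mQ]; exact hor i
    have pA : ∀ i, Sum.inl i ∈ P → Q.card ≤ b := fun i h => (leP _ h).trans (cA i).le
    have pB : ∀ i, Sum.inr i ∈ P → Q.card ≤ a := fun i h => (leP _ h).trans (cB i).le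
    have qA : ∀ i, Sum.inl i ∈ Q → P.card ≤ b := fun i h => (leQ _ h).trans (cA i).le
    have qB : ∀ i, Sum.inr i ∈ Q → P.card ≤ a := fun i h => (leQ _ h).trans (cB i).le
    have hfin : (P.card = a ∧ Q.card = b) ∨ (P.card = b ∧ Q.card = a) := by
      have x1 : Q.card ≤ b ∨ ∀ i, Sum.inl i ∈ Q := by
        by_cases c : ∃ i, Sum.inl i ∈ P
        · obtain ⟨i, hi⟩ := c; exact Or.inl (pA i hi)
        · push Not at c; exact Or.inr fun i => (hmem _).resolve_left (c i)
      have x2 : Q.card ≤ a ∨ ∀ i, Sum.inr i ∈ Q := by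
        by_cases c : ∃ i, Sum.inr i ∈ P
        · obtain ⟨i, hi⟩ := c; exact Or.inl (pB i hi)
        · push Not at c; exact Or.inr fun i => (hmem _).resolve_left (c i)
      have x3 : P.card ≤ b ∨ ∀ i, Sum.inl i ∈ P := by
        by_cases c : ∃ i, Sum.inl i ∈ Q
        · obtain ⟨i, hi⟩ := c; exact Or.inl (qA i hi)
        · push Not at c; exact Or.inr fun i => (hmem _).resolve_right (c i)
      have x4 : P.card ≤ a ∨ ∀ i, Sum.inr i ∈ P := by
        by_cases c : ∃ i, Sum.inr i ∈ Q
        · obtain ⟨i, hi⟩ := c; exact Or.inl (qB i hi)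
        · push Not at c; exact Or.inr fun i => (hmem _).resolve_right (c i)
      have y1 : Q.card ≤ b ∨ P.card ≤ b :=
        x1.imp_right fun h => qA ⟨0, by omega⟩ (h _)
      have y2 : Q.card ≤ a ∨ P.card ≤ a :=
        x2.imp_right fun h => qB ⟨0, by omega⟩ (h _)
      have y3 : Q.card ≤ b ∨ Q.card ≤ a := by
        obtain ⟨i | i, hi⟩ := hq
        · exact Or.inl (pA i hi)
        · exact Or.inr (pB i hi)
      have y4 : P.card ≤ b ∨ P.card ≤ a := by
        obtain ⟨i | i, hi⟩ := hp
        · exact Or.inl (qA i hi)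
        · exact Or.inr (qB i hi)
      omega
    have hab : P.card * Q.card = a * b := by
      rcases hfin with ⟨h1, h2⟩ | ⟨h1, h2⟩ <;> rw [h1, h2]
      ring
    rw [hab] at key
    have : 2 * a * b = a * b + a * b := by ring
    omega

/-- With `A₁, …, A_a` (of cardinality `b+1`), `M` (of cardinality `2`),
and `B₁, …, B_b` (of cardinality `a+1`) pairwise intersecting in exactly one element,
the union of all the sets has `2ab + 2` elements if all `a + b + 1` sets share a
common element, and `ab + 2` elements otherwise; the first count is strictly larger. -/
theorem stmt_1 {α : Type*} [DecidableEq α] (a b : ℕ) (ha : 2 ≤ a) (hb : 2 ≤ b)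
    (A : Fin a → Finset α) (M : Finset α) (B : Fin b → Finset α)
    (hA : ∀ i, (A i).card = b + 1) (hM : M.card = 2) (hB : ∀ j, (B j).card = a + 1)
    (hAA : ∀ i i', i ≠ i' → (A i ∩ A i').card = 1)
    (hAM : ∀ i, (A i ∩ M).card = 1)
    (hAB : ∀ i j, (A i ∩ B j).card = 1)
    (hMB : ∀ j, (M ∩ B j).card = 1)
    (hBB : ∀ j j', j ≠ j' → (B j ∩ B j').card = 1) :
    ((∃ x, (∀ i, x ∈ A i) ∧ x ∈ M ∧ (∀ j, x ∈ B j)) →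
      (Finset.univ.biUnion A ∪ M ∪ Finset.univ.biUnion B).card = 2 * a * b + 2) ∧
    ((¬ ∃ x, (∀ i, x ∈ A i) ∧ x ∈ M ∧ (∀ j, x ∈ B j)) →
      (Finset.univ.biUnion A ∪ M ∪ Finset.univ.biUnion B).card = a * b + 2) ∧
    a * b + 2 < 2 * a * b + 2 := by
  obtain ⟨p, q, hpq, rfl⟩ := Finset.card_eq_two.1 hM
  have main := aux_main a b (Sum.elim A B) p q hpq hA hB
    (by
      rintro (i | i) (j | j) hij
      · exact hAA i j (fun h => hij (by rw [h]))
      · exact hAB i j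
      · rw [Finset.inter_comm]; exact hAB j i
      · exact hBB i j (fun h => hij (by rw [h])))
    (by
      rintro (i | i)
      · exact hAM i
      · rw [Finset.inter_comm]; exact hMB i) ha hb
  have e1 : (Finset.univ.biUnion A ∪ {p, q} ∪ Finset.univ.biUnion B)
      = Finset.univ.biUnion (Sum.elim A B) ∪ {p, q} := by
    ext x
    simp only [Finset.mem_union, Finset.mem_biUnion, Finset.mem_univ, true_and, Sum.exists,
      Sum.elim_inl, Sum.elim_inr]
    tauto
  have e2 : (∃ x, (∀ i, x ∈ A i) ∧ x ∈ ({p, q} : Finset α) ∧ (∀ j, x ∈ B j)) ↔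
      (∃ x, (∀ i, x ∈ Sum.elim A B i) ∧ (x = p ∨ x = q)) := by
    refine exists_congr fun x => ?_
    simp only [Finset.mem_insert, Finset.mem_singleton, Sum.forall, Sum.elim_inl, Sum.elim_inr]
    tauto
  rw [e1, e2]
  refine ⟨main.1, main.2, ?_⟩
  have : 0 < a * b := by positivity
  have h2 : 2 * a * b = a * b + a * b := by ring
  omega
end

section
/- Let k ≥ 2 and let S₁, …, S_k be finite sets such that |Sᵢ ∩ Sⱼ| = 1 for all i ≠ j. Then |S₁ ∪ ⋯ ∪ S_k| ≤ (Σᵢ |Sᵢ|) − (k − 1), with equality if and only if there is an element common to all k sets; moreover, if there is no element common to all k sets, then |S₁ ∪ ⋯ ∪ S_k| ≤ (Σᵢ |Sᵢ|) − k. (This is the combinatorial heart of the proof of Theorem 3.1: among homological embeddings, the 'sunflower' configuration, in which all classes adjacent to the center share one common exceptional class, strictly maximizes the number of distinct exceptional classes used.) -/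
theorem aux_common {α : Type*} [DecidableEq α] (k : ℕ) (hk : 2 ≤ k)
    (S : Fin k → Finset α)
    (hS : ∀ i j, i ≠ j → (S i ∩ S j).card = 1) (x : α) (hx : ∀ i, x ∈ S i) :
    (Finset.univ.biUnion S).card + (k - 1) = ∑ i, (S i).card := by
  have h1 : Finset.univ.biUnion S = insert x (Finset.univ.biUnion fun i => (S i).erase x) := by
    ext y
    simp only [Finset.mem_biUnion, Finset.mem_univ, true_and, Finset.mem_insert, Finset.mem_erase]
    constructor
    · rintro ⟨i, hi⟩
      by_cases h : y = x
      · exact Or.inl h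
      · exact Or.inr ⟨i, h, hi⟩
    · rintro (h | ⟨i, _, hi⟩)
      · exact ⟨⟨0, by omega⟩, h ▸ hx _⟩
      · exact ⟨i, hi⟩
  have h2 : x ∉ (Finset.univ.biUnion fun i => (S i).erase x) := by simp
  rw [h1, Finset.card_insert_of_notMem h2, Finset.card_biUnion]
  · have h3 : ∑ i, (S i).card = ∑ i, (((S i).erase x).card + 1) :=
      Finset.sum_congr rfl fun i _ => (Finset.card_erase_add_one (hx i)).symm
    rw [h3, Finset.sum_add_distrib]
    simp only [Finset.sum_const, Finset.card_univ, Fintype.card_fin, smul_eq_mul]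
    omega
  · intro i _ j _ hij
    rw [Function.onFun_apply]
    rw [Finset.disjoint_left]
    intro y hy hy'
    obtain ⟨z, hz⟩ := Finset.card_eq_one.1 (hS i j hij)
    have a : x ∈ S i ∩ S j := Finset.mem_inter.2 ⟨hx i, hx j⟩
    have b : y ∈ S i ∩ S j :=
      Finset.mem_inter.2 ⟨Finset.mem_of_mem_erase hy, Finset.mem_of_mem_erase hy'⟩
    rw [hz, Finset.mem_singleton] at a b
    exact Finset.ne_of_mem_erase hy (b.trans a.symm)

theorem aux_not_common {α : Type*} [DecidableEq α] (k : ℕ) (hk : 2 ≤ k)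
    (S : Fin k → Finset α)
    (hS : ∀ i j, i ≠ j → (S i ∩ S j).card = 1) (hx : ¬ ∃ x, ∀ i, x ∈ S i) :
    (Finset.univ.biUnion S).card + k ≤ ∑ i, (S i).card := by
  set U := Finset.univ.biUnion S with hU
  have hsub : ∀ i, S i ⊆ U := fun i => Finset.subset_biUnion_of_mem S (Finset.mem_univ i)
  let f : Fin k → α → ℤ := fun i x => if x ∈ S i then 1 else 0
  let d : α → ℤ := fun x => ∑ i, f i x
  have e1 : ∀ i, ((S i).card : ℤ) = ∑ x ∈ U, f i x := by
    intro i
    simp only [f, Finset.sum_boole, Finset.filter_mem_eq_inter,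
      Finset.inter_eq_right.2 (hsub i)]
  have e2 : ∀ i j, ((S i ∩ S j).card : ℤ) = ∑ x ∈ U, f i x * f j x := by
    intro i j
    have : ∀ x, f i x * f j x = if x ∈ S i ∩ S j then 1 else 0 := by
      intro x
      simp only [f, Finset.mem_inter]
      split_ifs <;> simp_all
    simp only [this, Finset.sum_boole, Finset.filter_mem_eq_inter,
      Finset.inter_eq_right.2 (Finset.inter_subset_left.trans (hsub i))]
  have s1 : ((∑ i, (S i).card : ℕ) : ℤ) = ∑ x ∈ U, d x := by
    push_cast
    simp only [e1, d]
    exact Finset.sum_comm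
  have s2 : ∑ i, ∑ j, ((S i ∩ S j).card : ℤ) = ∑ x ∈ U, d x * d x := by
    simp only [e2, d, Finset.sum_mul_sum]
    rw [Finset.sum_comm (s := U)]
    exact Finset.sum_congr rfl fun i _ => Finset.sum_comm
  have s3 : ∑ i, ∑ j, ((S i ∩ S j).card : ℤ) = ∑ x ∈ U, d x + k * (k - 1) := by
    rw [← s1]
    have : ∀ i, ∑ j, ((S i ∩ S j).card : ℤ) = (S i).card + (k - 1) := by
      intro i
      rw [← Finset.add_sum_erase _ _ (Finset.mem_univ i), Finset.inter_self]
      congr 1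
      rw [Finset.sum_congr rfl (g := fun _ => (1 : ℤ))]
      · simp
        omega
      · intro j hj
        rw [hS i j (Finset.ne_of_mem_erase hj).symm]; rfl
    simp only [this, Finset.sum_add_distrib]
    simp
    ring
  have b1 : ∀ x ∈ U, 1 ≤ d x := by
    intro x hxU
    obtain ⟨i, _, hi⟩ := Finset.mem_biUnion.1 hxU
    have : f i x ≤ d x := Finset.single_le_sum (f := fun i => f i x)
      (fun j _ => by simp only [f]; split_ifs <;> simp) (Finset.mem_univ i)
    simpa [f, hi] using this
  have b2 : ∀ x ∈ U, d x ≤ k - 1 := by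
    intro x _
    push Not at hx
    obtain ⟨i, hi⟩ := hx x
    have : d x < ∑ i : Fin k, (1 : ℤ) := Finset.sum_lt_sum
      (fun j _ => by simp only [f]; split_ifs <;> simp) ⟨i, Finset.mem_univ i, by simp [f, hi]⟩
    simp at this
    omega
  have key : ∑ x ∈ U, d x * (d x - 1) ≤ ∑ x ∈ U, ((k : ℤ) - 1) * (d x - 1) :=
    Finset.sum_le_sum fun x h =>
      mul_le_mul_of_nonneg_right (b2 x h) (by linarith [b1 x h])
  rw [← Finset.mul_sum, Finset.sum_sub_distrib] at key
  simp only [mul_sub, mul_one, Finset.sum_sub_distrib, Finset.sum_const, nsmul_eq_mul] at key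
  have hk' : (0 : ℤ) < (k : ℤ) - 1 := by
    have : (2 : ℤ) ≤ k := by exact_mod_cast hk
    linarith
  have fin : (k : ℤ) ≤ ∑ x ∈ U, d x - U.card := by
    refine le_of_mul_le_mul_left ?_ hk'
    linarith
  rw [← s1] at fin
  have : ((U.card + k : ℕ) : ℤ) ≤ ((∑ i, (S i).card : ℕ) : ℤ) := by
    push_cast at fin ⊢
    linarith
  exact_mod_cast this

/-- If `S₁, …, S_k` (`k ≥ 2`) are finite sets with `|Sᵢ ∩ Sⱼ| = 1`
for all `i ≠ j`, then `|S₁ ∪ ⋯ ∪ S_k| ≤ (Σᵢ |Sᵢ|) − (k − 1)`, with equality iff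
there is an element common to all `k` sets; and if there is no common element
then `|S₁ ∪ ⋯ ∪ S_k| ≤ (Σᵢ |Sᵢ|) − k`.  (Stated additively to avoid truncated
natural subtraction; this is equivalent since `k ≥ 2` and each `Sᵢ` is nonempty.) -/
theorem stmt_2 {α : Type*} [DecidableEq α] (k : ℕ) (hk : 2 ≤ k)
    (S : Fin k → Finset α)
    (hS : ∀ i j, i ≠ j → (S i ∩ S j).card = 1) :
    (Finset.univ.biUnion S).card + (k - 1) ≤ ∑ i, (S i).card ∧
    ((Finset.univ.biUnion S).card + (k - 1) = ∑ i, (S i).card ↔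
      ∃ x, ∀ i, x ∈ S i) ∧
    ((¬ ∃ x, ∀ i, x ∈ S i) →
      (Finset.univ.biUnion S).card + k ≤ ∑ i, (S i).card) := by
  by_cases h : ∃ x, ∀ i, x ∈ S i
  · obtain ⟨x, hx⟩ := h
    have := aux_common k hk S hS x hx
    exact ⟨this.le, ⟨fun _ => ⟨x, hx⟩, fun _ => this⟩, fun h => (h ⟨x, hx⟩).elim⟩
  · have := aux_not_common k hk S hS h
    exact ⟨by omega, ⟨fun e => by omega, fun e => (h e).elim⟩, fun _ => this⟩
end

section
/- In the intersection lattice of ℂP² # N(−ℂP²): let T, T' be finite sets of indices in {1,…,N}, let k ∉ T and k' ∉ T', and set w = e_k − e_T and w' = e_{k'} − e_{T'}. If Q(w, w') = 1, then k ≠ k', and exactly one of the following holds: (i) k ∈ T', k' ∉ T, and T ∩ T' = ∅; (ii) k' ∈ T, k ∉ T', and T ∩ T' = ∅; (iii) k ∈ T', k' ∈ T, and |T ∩ T'| = 1. (Lemma 4.4 of the paper, on consecutive spheres within an arm of the cap.) -/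
/-- The intersection form of `ℂP² # N(−ℂP²)` on `H₂ ≅ ℤ⟨h⟩ ⊕ ℤ⟨e₁⟩ ⊕ ⋯ ⊕ ℤ⟨e_N⟩`,
modeled on `ℤ × (Fin N → ℤ)` (the `h`-coefficient and the `e`-coefficients):
`Q(h,h) = 1`, `Q(eᵢ,eᵢ) = −1`, `Q(h,eᵢ) = Q(eᵢ,eⱼ) = 0` for `i ≠ j`. -/
def Qform (N : ℕ) (v w : ℤ × (Fin N → ℤ)) : ℤ :=
  v.1 * w.1 - ∑ i, v.2 i * w.2 i

/-- The class `h` of a line. -/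
def hvec (N : ℕ) : ℤ × (Fin N → ℤ) := (1, 0)

/-- For a finite set `S` of indices, `e_S := Σ_{i ∈ S} eᵢ`. -/
def eS (N : ℕ) (S : Finset (Fin N)) : ℤ × (Fin N → ℤ) :=
  (0, fun i => if i ∈ S then 1 else 0)

/-- Lemma 4.4: if `w = e_k − e_T`, `w' = e_{k'} − e_{T'}` with
`k ∉ T`, `k' ∉ T'` and `Q(w,w') = 1`, then `k ≠ k'` and exactly one of:
(i) `k ∈ T'`, `k' ∉ T`, `T ∩ T' = ∅`; (ii) `k' ∈ T`, `k ∉ T'`, `T ∩ T' = ∅`;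
(iii) `k ∈ T'`, `k' ∈ T`, `|T ∩ T'| = 1` holds.  (The three alternatives are
mutually exclusive as stated, so the disjunction expresses "exactly one".) -/
theorem stmt_5 (N : ℕ) (hN : 1 ≤ N) (T T' : Finset (Fin N)) (k k' : Fin N)
    (hk : k ∉ T) (hk' : k' ∉ T')
    (h : Qform N (eS N {k} - eS N T) (eS N {k'} - eS N T') = 1) :
    k ≠ k' ∧
      ((k ∈ T' ∧ k' ∉ T ∧ T ∩ T' = ∅) ∨
       (k' ∈ T ∧ k ∉ T' ∧ T ∩ T' = ∅) ∨
       (k ∈ T' ∧ k' ∈ T ∧ (T ∩ T').card = 1)) := by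
  have key : (∑ i, ((if i = k then (1:ℤ) else 0) - (if i ∈ T then 1 else 0)) *
      ((if i = k' then (1:ℤ) else 0) - (if i ∈ T' then 1 else 0))) =
      (if k = k' then 1 else 0) - (if k ∈ T' then 1 else 0) - (if k' ∈ T then 1 else 0)
        + ((T ∩ T').card : ℤ) := by
    have h1 : ∀ i, ((if i = k then (1:ℤ) else 0) - (if i ∈ T then 1 else 0)) *
      ((if i = k' then (1:ℤ) else 0) - (if i ∈ T' then 1 else 0)) =
      (if i = k then (if k = k' then 1 else 0) else 0)
        - (if i = k then (if k ∈ T' then 1 else 0) else 0)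
        - (if i = k' then (if k' ∈ T then 1 else 0) else 0)
        + (if i ∈ T ∩ T' then 1 else 0) := by
      intro i
      have e1 : (if i = k then (if k = k' then (1:ℤ) else 0) else 0)
          = (if i = k then 1 else 0) * (if i = k' then 1 else 0) := by
        by_cases a : i = k <;> simp [a]
      have e2 : (if i = k then (if k ∈ T' then (1:ℤ) else 0) else 0)
          = (if i = k then 1 else 0) * (if i ∈ T' then 1 else 0) := by
        by_cases a : i = k <;> simp [a]
      have e3 : (if i = k' then (if k' ∈ T then (1:ℤ) else 0) else 0)
          = (if i = k' then 1 else 0) * (if i ∈ T then 1 else 0) := by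
        by_cases a : i = k' <;> simp [a]
      have e4 : (if i ∈ T ∩ T' then (1:ℤ) else 0)
          = (if i ∈ T then 1 else 0) * (if i ∈ T' then 1 else 0) := by
        by_cases a : i ∈ T <;> simp [a]
      rw [e1, e2, e3, e4]
      ring
    rw [Finset.sum_congr rfl (fun i _ => h1 i), Finset.sum_add_distrib,
      Finset.sum_sub_distrib, Finset.sum_sub_distrib, Finset.sum_ite_eq' Finset.univ k,
      Finset.sum_ite_eq' Finset.univ k, Finset.sum_ite_eq' Finset.univ k']
    simp only [Finset.mem_univ, if_true, Finset.sum_boole, Finset.filter_univ_mem]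
  have h2 : Qform N (eS N {k} - eS N T) (eS N {k'} - eS N T') =
      - (∑ i, ((if i = k then (1:ℤ) else 0) - (if i ∈ T then 1 else 0)) *
      ((if i = k' then (1:ℤ) else 0) - (if i ∈ T' then 1 else 0))) := by
    simp [Qform, eS]
  rw [h2, key] at h
  rw [← Finset.card_eq_zero]
  by_cases a : k = k'
  · subst a
    simp only [hk, hk', if_true, if_false] at h
    omega
  · refine ⟨a, ?_⟩
    by_cases b : k ∈ T' <;> by_cases c : k' ∈ T <;>
      simp only [a, b, c, if_true, if_false] at h ⊢ <;> simp <;> first | omega | (rw [← Finset.card_eq_zero]; omega)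
end

section
/- In the intersection lattice of ℂP² # N(−ℂP²): let T, T' be finite sets of indices in {1,…,N}, let k ∉ T and k' ∉ T', set w = e_k − e_T and w' = e_{k'} − e_{T'}, and suppose Q(w, w') = 0 and (T ∪ {k}) ∩ (T' ∪ {k'}) ≠ ∅. Then k ≠ k' and at least one of the following holds: (1) k ∈ T'; (2) k' ∈ T. If exactly one of (1), (2) holds then |T ∩ T'| = 1, and if both hold then |T ∩ T'| = 2. (Lemma 4.6 of the paper, for two disjoint cap spheres not lying consecutively in an arm and not both adjacent to the central sphere.) -/
/-- Lemma 4.6: if `w = e_k − e_T`, `w' = e_{k'} − e_{T'}` with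
`k ∉ T`, `k' ∉ T'`, `Q(w,w') = 0` and `(T ∪ {k}) ∩ (T' ∪ {k'}) ≠ ∅`, then
`k ≠ k'`, at least one of `k ∈ T'`, `k' ∈ T` holds, and if exactly one holds
then `|T ∩ T'| = 1` while if both hold then `|T ∩ T'| = 2`. -/
theorem stmt_7 (N : ℕ) (hN : 1 ≤ N) (T T' : Finset (Fin N)) (k k' : Fin N)
    (hk : k ∉ T) (hk' : k' ∉ T')
    (h : Qform N (eS N {k} - eS N T) (eS N {k'} - eS N T') = 0)
    (hmeet : (T ∪ {k}) ∩ (T' ∪ {k'}) ≠ ∅) :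
    k ≠ k' ∧ (k ∈ T' ∨ k' ∈ T) ∧
      (((k ∈ T' ∧ k' ∉ T) ∨ (k' ∈ T ∧ k ∉ T')) → (T ∩ T').card = 1) ∧
      ((k ∈ T' ∧ k' ∈ T) → (T ∩ T').card = 2) := by
  have key : (if k = k' then (1:ℤ) else 0) - (if k ∈ T' then 1 else 0)
      - (if k' ∈ T then 1 else 0) + ((T ∩ T').card : ℤ) = 0 := by
    have e : ∀ i : Fin N, (eS N {k} - eS N T).2 i * (eS N {k'} - eS N T').2 i =
        (if i = k then (if k = k' then (1:ℤ) else 0) else 0)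
        - (if i = k then (if k ∈ T' then (1:ℤ) else 0) else 0)
        - (if i = k' then (if k' ∈ T then (1:ℤ) else 0) else 0)
        + (if i ∈ T ∩ T' then (1:ℤ) else 0) := by
      intro i
      simp only [eS, Prod.snd_sub, Pi.sub_apply, Finset.mem_singleton, Finset.mem_inter]
      clear h hmeet
      by_cases a : i = k
      · subst a
        by_cases b : i = k'
        · subst b
          simp [hk, hk']
        · by_cases d : i ∈ T' <;> simp [hk, b, d]
      · by_cases b : i = k'
        · subst b
          by_cases c : i ∈ T <;> simp [hk', a, c]
        · by_cases c : i ∈ T <;> by_cases d : i ∈ T' <;> simp [a, b, c, d]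
    unfold Qform at h
    rw [Finset.sum_congr rfl (fun i _ => e i)] at h
    rw [Finset.sum_add_distrib, Finset.sum_sub_distrib, Finset.sum_sub_distrib] at h
    simp only [Finset.sum_ite_eq', Finset.sum_ite_eq, Finset.mem_univ, if_true,
      Finset.sum_boole, Finset.filter_univ_mem] at h
    simp only [eS, Prod.fst_sub] at h
    linarith
  have hkk : k ≠ k' := by
    rintro rfl
    simp only [hk, hk', if_true, if_false] at key
    omega
  simp only [hkk, if_false] at key
  refine ⟨hkk, ?_, ?_, ?_⟩
  · by_contra hc
    push Not at hc
    simp only [hc.1, hc.2, if_false] at key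
    have h0 : T ∩ T' = ∅ := by
      rw [← Finset.card_eq_zero]; omega
    apply hmeet
    ext i
    have hi : i ∉ T ∩ T' := by simp [h0]
    simp only [Finset.mem_inter, Finset.mem_union, Finset.mem_singleton] at hi ⊢
    grind
  · rintro (⟨h1, h2⟩ | ⟨h1, h2⟩) <;> simp only [h1, h2, if_true, if_false] at key <;> omega
  · rintro ⟨h1, h2⟩
    simp only [h1, h2, if_true] at key
    omega
end

section
/- In the intersection lattice of ℂP² # N(−ℂP²): let m ≥ 3, let S be a finite set of indices, and for p = 2,…,m let T_p be finite sets of indices and k_p indices with k_p ∉ T_p. Set w₁ = h − e_S and w_p = e_{k_p} − e_{T_p} for p ≥ 2, and suppose Q(w₁, w₂) = 1 and Q(w_p, w_{p+1}) = 1 for all 2 ≤ p ≤ m−1 (the intersection pattern of the spheres in one arm of a cap plumbing). Write E₁ = S and E_p = T_p ∪ {k_p} for p ≥ 2 for the set of exceptional indices appearing with nonzero coefficient in w_p. If for some p with 2 ≤ p ≤ m−1 we have k_p ∈ T_{p+1} (the exceptional class with coefficient +1 in w_p appears with coefficient −1 in w_{p+1}), then there exist indices q₁, q₂ with q₂ ≥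 q₁ + 2 and E_{q₁} ∩ E_{q₂} ≠ ∅, i.e., some exceptional class appears with nonzero coefficient in two non-consecutive classes of the arm. (The claim established in the second-to-last paragraph of the proof of Theorem 3.1.) -/
/-- claim in the proof of Theorem 3.1: in one arm of a cap
plumbing, with `w₁ = h − e_S`, `w_p = e_{k_p} − e_{T_p}` (`k_p ∉ T_p`) for
`2 ≤ p ≤ m` and `Q(w_p, w_{p+1}) = 1` for `1 ≤ p ≤ m − 1`, let
`E₁ = S` and `E_p = T_p ∪ {k_p}` be the sets of exceptional indices appearing
with nonzero coefficient.  If for some `2 ≤ p ≤ m − 1` the class with `+1`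
coefficient in `w_p` appears with `−1` coefficient in `w_{p+1}` (i.e.
`k_p ∈ T_{p+1}`), then some exceptional class appears with nonzero coefficient
in two non-consecutive classes of the arm: there are `q₁, q₂` with
`1 ≤ q₁`, `q₂ ≤ m`, `q₂ ≥ q₁ + 2` and `E_{q₁} ∩ E_{q₂} ≠ ∅`. -/
theorem stmt_9 (N : ℕ) (hN : 1 ≤ N) (m : ℕ) (hm : 3 ≤ m)
    (S : Finset (Fin N)) (T : ℕ → Finset (Fin N)) (k : ℕ → Fin N)
    (hkT : ∀ p, 2 ≤ p → p ≤ m → k p ∉ T p)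
    (w : ℕ → ℤ × (Fin N → ℤ))
    (hw1 : w 1 = hvec N - eS N S)
    (hwp : ∀ p, 2 ≤ p → p ≤ m → w p = eS N {k p} - eS N (T p))
    (hQ : ∀ p, 1 ≤ p → p ≤ m - 1 → Qform N (w p) (w (p + 1)) = 1)
    (E : ℕ → Finset (Fin N))
    (hE1 : E 1 = S)
    (hEp : ∀ p, 2 ≤ p → p ≤ m → E p = insert (k p) (T p))
    (hyp : ∃ p, 2 ≤ p ∧ p ≤ m - 1 ∧ k p ∈ T (p + 1)) :
    ∃ q₁ q₂, 1 ≤ q₁ ∧ q₂ ≤ m ∧ q₁ + 2 ≤ q₂ ∧ (E q₁ ∩ E q₂).Nonempty := by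
  have h2 : k 2 ∈ S := by
    by_contra hk
    have h := hQ 1 le_rfl (by omega)
    rw [hw1, hwp 2 le_rfl (by omega)] at h
    simp only [Qform, hvec, eS, Prod.fst_sub, Prod.snd_sub, Pi.sub_apply] at h
    have hs : 0 ≤ ∑ i, (((0 : Fin N → ℤ) i - if i ∈ S then 1 else 0) *
        ((if i ∈ ({k 2} : Finset (Fin N)) then 1 else 0) - if i ∈ T 2 then 1 else 0)) := by
      apply Finset.sum_nonneg
      intro i _
      by_cases hi : i = k 2
      · subst hi
        simp [hk]
      · simp only [Finset.mem_singleton, hi, Pi.zero_apply]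
        split_ifs <;> simp_all
    linarith
  have hstep : ∀ p, 2 ≤ p → p + 1 ≤ m → k p ∈ T (p + 1) ∨ k (p + 1) ∈ T p := by
    intro p hp hpm
    by_contra! hk
    obtain ⟨hk1, hk2⟩ := hk
    have h := hQ p (by omega) (by omega)
    rw [hwp p hp (by omega), hwp (p + 1) (by omega) hpm] at h
    simp only [Qform, eS, Prod.fst_sub, Prod.snd_sub, Pi.sub_apply] at h
    have hs : 0 ≤ ∑ i, (((if i ∈ ({k p} : Finset (Fin N)) then (1 : ℤ) else 0) -
          if i ∈ T p then 1 else 0) *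
        ((if i ∈ ({k (p + 1)} : Finset (Fin N)) then 1 else 0) -
          if i ∈ T (p + 1) then 1 else 0)) := by
      apply Finset.sum_nonneg
      intro i _
      have a1 : i = k p → i ∉ T (p + 1) := fun e => e ▸ hk1
      have a2 : i = k (p + 1) → i ∉ T p := fun e => e ▸ hk2
      simp only [Finset.mem_singleton]
      split_ifs <;> simp_all
    linarith
  have main : ∀ p, 2 ≤ p → p + 1 ≤ m → k p ∈ T (p + 1) →
      ∃ q₁ q₂, 1 ≤ q₁ ∧ q₂ ≤ m ∧ q₁ + 2 ≤ q₂ ∧ (E q₁ ∩ E q₂).Nonempty := by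
    intro p hp
    induction p, hp using Nat.le_induction with
    | base =>
      intro hpm hk
      refine ⟨1, 3, le_rfl, hpm, le_rfl, k 2, ?_⟩
      rw [hE1, hEp 3 (by omega) hpm]
      exact Finset.mem_inter.2 ⟨h2, Finset.mem_insert_of_mem hk⟩
    | succ p hp ih =>
      intro hpm hk
      rcases hstep p hp (by omega) with h | h
      · exact ih (by omega) h
      · refine ⟨p, p + 1 + 1, by omega, hpm, by omega, k (p + 1), ?_⟩
        rw [hEp p hp (by omega), hEp (p + 1 + 1) (by omega) hpm]
        exact Finset.mem_inter.2 ⟨Finset.mem_insert_of_mem h, Finset.mem_insert_of_mem hk⟩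
  obtain ⟨p, hp, hpm, hk⟩ := hyp
  exact main p hp (by omega) hk
end

section
/- Fix integers a, b ≥ 2 and consider the free ℤ-module with basis h, e₁, e₂, and e_{i,j} for 1 ≤ i ≤ a and 1 ≤ j ≤ b (so N = ab + 2 exceptional basis vectors), with the bilinear form Q as in the context. Define C₀ = h, Cᵢ = h − e₁ − Σ_{j=1}^{b} e_{i,j} for 1 ≤ i ≤ a, C' = h − e₁ − e₂, and D_j = h − e₂ − Σ_{i=1}^{a} e_{i,j} for 1 ≤ j ≤ b. Then: Q(C₀,C₀) = 1; Q(Cᵢ,Cᵢ) = −b for each i; Q(C',C') = −1; Q(D_j,D_j) = −a for each j; Q(C₀, X) = 1 for X any of the Cᵢ, C', D_j; and Q(X, Y) = 0 for any two distinct classes X ≠ Y among {C₁,…,C_a, C', D₁,…,D_b}. That is, these classes realize, in the homology lattice of ℂP² # (ab+2)(−ℂP²), the intersection matrix of the concave cap plumbing DΓ_{a,b} (a central +1 vertex joined to a vertices of weight −b, one vertex of weight −1, and b vertices of weight −a). (The second homological embedding in the proof of Theorem 5.1, arising from the line arrangement of Figure 3.) -/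
/-- The intersection form of a blow-up of `ℂP²` on its second homology, modeled
on `ℤ × (ι → ℤ)` (the coefficient of the line class `h` and the coefficients of
the exceptional classes `eₓ`, `x : ι`): `Q(h,h) = 1`, `Q(eₓ,eₓ) = −1`, and all
other pairings of distinct basis vectors vanish. -/
def QQ {ι : Type*} [Fintype ι] (v w : ℤ × (ι → ℤ)) : ℤ :=
  v.1 * w.1 - ∑ i, v.2 i * w.2 i

/-- The class `h` of a line. -/
def hh (ι : Type*) : ℤ × (ι → ℤ) := (1, 0)

/-- The exceptional class `eₓ`. -/
def ee {ι : Type*} [DecidableEq ι] (x : ι) : ℤ × (ι → ℤ) :=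
  (0, fun i => if i = x then 1 else 0)

/-- in the homology lattice of `ℂP² # (ab+2)(−ℂP²)` with
exceptional classes `e₁, e₂` (indexed by `Fin 2`) and `e_{i,j}`
(indexed by `Fin a × Fin b`), the classes `C₀ = h`,
`Cᵢ = h − e₁ − Σⱼ e_{i,j}`, `C' = h − e₁ − e₂`, `D_j = h − e₂ − Σᵢ e_{i,j}`
realize the intersection matrix of the concave cap plumbing `DΓ_{a,b}`:
self-intersections `1, −b, −1, −a`, each class pairing `1` with the central
`C₀` and `0` with every other distinct class. -/
theorem stmt_10 (a b : ℕ) (ha : 2 ≤ a) (hb : 2 ≤ b)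
    (C₀ : ℤ × (Fin 2 ⊕ Fin a × Fin b → ℤ))
    (C : Fin a → ℤ × (Fin 2 ⊕ Fin a × Fin b → ℤ))
    (C' : ℤ × (Fin 2 ⊕ Fin a × Fin b → ℤ))
    (D : Fin b → ℤ × (Fin 2 ⊕ Fin a × Fin b → ℤ))
    (hC₀ : C₀ = hh (Fin 2 ⊕ Fin a × Fin b))
    (hC : ∀ i, C i = hh (Fin 2 ⊕ Fin a × Fin b) - ee (Sum.inl 0)
      - ∑ j : Fin b, ee (Sum.inr (i, j)))
    (hC' : C' = hh (Fin 2 ⊕ Fin a × Fin b) - ee (Sum.inl 0) - ee (Sum.inl 1))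
    (hD : ∀ j, D j = hh (Fin 2 ⊕ Fin a × Fin b) - ee (Sum.inl 1)
      - ∑ i : Fin a, ee (Sum.inr (i, j))) :
    QQ C₀ C₀ = 1 ∧
    (∀ i, QQ (C i) (C i) = -(b : ℤ)) ∧
    QQ C' C' = -1 ∧
    (∀ j, QQ (D j) (D j) = -(a : ℤ)) ∧
    (∀ i, QQ C₀ (C i) = 1) ∧
    QQ C₀ C' = 1 ∧
    (∀ j, QQ C₀ (D j) = 1) ∧
    (∀ i i', i ≠ i' → QQ (C i) (C i') = 0) ∧
    (∀ i, QQ (C i) C' = 0) ∧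
    (∀ i j, QQ (C i) (D j) = 0) ∧
    (∀ j, QQ C' (D j) = 0) ∧
    (∀ j j', j ≠ j' → QQ (D j) (D j') = 0) := by
  have eC : ∀ i, C i = (1, Sum.elim ![-1, 0] (fun p => if p.1 = i then -1 else 0)) := by
    intro i
    rw [hC]
    refine Prod.ext (by simp [hh, ee, Prod.fst_sum]) ?_
    funext x
    rcases x with x | ⟨p, q⟩
    · fin_cases x <;> simp [hh, ee, Prod.snd_sum]
    · by_cases h : p = i <;> simp [hh, ee, Prod.snd_sum, h]
  have eD : ∀ j, D j = (1, Sum.elim ![0, -1] (fun p => if p.2 = j then -1 else 0)) := by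
    intro j
    rw [hD]
    refine Prod.ext (by simp [hh, ee, Prod.fst_sum]) ?_
    funext x
    rcases x with x | ⟨p, q⟩
    · fin_cases x <;> simp [hh, ee, Prod.snd_sum]
    · by_cases h : q = j <;> simp [hh, ee, Prod.snd_sum, h]
  have eC' : C' = (1, Sum.elim ![-1, -1] (fun _ => 0)) := by
    rw [hC']
    refine Prod.ext (by simp [hh, ee]) ?_
    funext x
    rcases x with x | ⟨p, q⟩
    · fin_cases x <;> simp [hh, ee]
    · simp [hh, ee]
  refine ⟨?_, ?_, ?_, ?_, ?_, ?_, ?_, ?_, ?_, ?_, ?_, ?_⟩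
  · simp [hC₀, QQ, hh]
  · intro i
    simp [eC, QQ, Fintype.sum_prod_type]
  · simp [eC', QQ]
  · intro j
    simp [eD, QQ, Fintype.sum_prod_type]
  · intro i
    simp [hC₀, eC, QQ, hh]
  · simp [hC₀, eC', QQ, hh]
  · intro j
    simp [hC₀, eD, QQ, hh]
  · intro i i' h
    simp [eC, QQ, Fintype.sum_prod_type, h, h.symm]
  · intro i
    simp [eC, eC', QQ]
  · intro i j
    simp [eC, eD, QQ, Fintype.sum_prod_type]
  · intro j
    simp [eD, eC', QQ]
  · intro j j' h
    simp [eD, QQ, Fintype.sum_prod_type, h, h.symm]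
end
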